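/- Let R ⊆ E be an extension of Rota-Baxter family Hom-associative algebras of weight λ, ρ : E → R a linear retraction, V := ker ρ, and Ω(R,V) := Υ₁(E). Call two deformation maps d, D : V → R of Ω(R,V) equivalent (d ∼ D) if there exists a linear automorphism δ of V such that, for all x, y ∈ V and ω ∈ S: δ(x ·_V y) − δ(x) ·_V δ(y) = D(δ(x))▷δ(y) + δ(x)◁D(δ(y)) − δ(d(x)▷y) − δ(x◁d(y)); δ(P_{ω,V}(x)) = P_{ω,V}(δ(x)); δ(θ_V(x)) = θ_V(δ(x)). Then the bijection Δ₁ : C(R,E) → D(R,V) induces a bijection Δ : CH²(R,E) → H²(R,V), where CH²(R,E) is the set of isomorphism classes (as Rota-Baxter family Hom-associative algebras) of Rota-Baxter family Hom complements of R in E and H²(R,V) := D(R,V)/∼, sending the class [B] to the class [Δ₁(B)]. In particular, the index [E : R] (the cardinal of the set of isomorphism classes of Rota-Baxter family Hom complements of R in E) equals |H²(R,V)|. -/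

import Mathlib

/-- The data of a Rota-Baxter family Hom-associative algebra: a bilinear
multiplication, a family of linear operators indexed by a semigroup `S`,
and a linear twisting map. -/
structure RBFData (k S R : Type*) [Field k] [Semigroup S]
    [AddCommGroup R] [Module k R] where
  mul : R →ₗ[k] R →ₗ[k] R
  P : S → R →ₗ[k] R
  theta : R →ₗ[k] R

/-- The axioms of a Rota-Baxter family Hom-associative algebra of weight `lam`,
stated for arbitrary operations. -/
def IsRBFOps {k S M : Type*} [Field k] [Semigroup S] [AddCommGroup M] [Module k M]
    (lam : k) (mul : M → M → M) (P : S → M → M) (theta : M → M) : Prop :=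
  (∀ x y z : M, mul (theta x) (mul y z) = mul (mul x y) (theta z)) ∧
  (∀ (α β : S) (x y : M), mul (P α x) (P β y)
      = P (α * β) (mul (P α x) y + mul x (P β y) + lam • mul x y)) ∧
  (∀ (ω : S) (x : M), P ω (theta x) = theta (P ω x))

/-- `(R, ·, (P_ω), θ)` is a Rota-Baxter family Hom-associative algebra of weight `lam`. -/
def RBFData.IsRBF {k S R : Type*} [Field k] [Semigroup S] [AddCommGroup R] [Module k R]
    (A : RBFData k S R) (lam : k) : Prop :=
  IsRBFOps lam (fun x y => A.mul x y) (fun ω x => A.P ω x) (fun x => A.theta x)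

/-- An extending datum `Ω(R,V)` of `R` through `V`:
`dR` is `▷ : R×V→V`, `dL` is `◁ : V×R→V`, `hR` is `⇀ : V×R→R`, `hL` is `↼ : R×V→R`,
`f : V×V→R` is the cocycle, `mulV : V×V→V`, and the linear maps
`Q_ω : V→R`, `PV_ω : V→V`, `eta : V→R`, `thetaV : V→V`. -/
structure ExtDatum (k S R V : Type*) [Field k] [Semigroup S]
    [AddCommGroup R] [Module k R] [AddCommGroup V] [Module k V] where
  dR : R →ₗ[k] V →ₗ[k] V
  dL : V →ₗ[k] R →ₗ[k] V
  hR : V →ₗ[k] R →ₗ[k] R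
  hL : R →ₗ[k] V →ₗ[k] R
  f : V →ₗ[k] V →ₗ[k] R
  mulV : V →ₗ[k] V →ₗ[k] V
  Q : S → V →ₗ[k] R
  PV : S → V →ₗ[k] V
  eta : V →ₗ[k] R
  thetaV : V →ₗ[k] V

/-- The multiplication of the (prospective) unified product `R ♮ V`. -/
def natMul {k S R V : Type*} [Field k] [Semigroup S]
    [AddCommGroup R] [Module k R] [AddCommGroup V] [Module k V]
    (A : RBFData k S R) (D : ExtDatum k S R V) : R × V → R × V → R × V := fun p q =>
  (A.mul p.1 q.1 + D.hL p.1 q.2 + D.hR p.2 q.1 + D.f p.2 q.2,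
   D.dR p.1 q.2 + D.dL p.2 q.1 + D.mulV p.2 q.2)

/-- The Rota-Baxter family of the (prospective) unified product `R ♮ V`. -/
def natP {k S R V : Type*} [Field k] [Semigroup S]
    [AddCommGroup R] [Module k R] [AddCommGroup V] [Module k V]
    (A : RBFData k S R) (D : ExtDatum k S R V) : S → R × V → R × V := fun ω p =>
  (A.P ω p.1 + D.Q ω p.2, D.PV ω p.2)

/-- The twisting map of the (prospective) unified product `R ♮ V`. -/
def natTheta {k S R V : Type*} [Field k] [Semigroup S]
    [AddCommGroup R] [Module k R] [AddCommGroup V] [Module k V]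
    (A : RBFData k S R) (D : ExtDatum k S R V) : R × V → R × V := fun p =>
  (A.theta p.1 + D.eta p.2, D.thetaV p.2)

/-- An extending datum is a Rota-Baxter family Hom extending structure when the
unified product `R ♮ V` is a Rota-Baxter family Hom-associative algebra of weight `lam`. -/
def IsExtendingStructure {k S R V : Type*} [Field k] [Semigroup S]
    [AddCommGroup R] [Module k R] [AddCommGroup V] [Module k V]
    (lam : k) (A : RBFData k S R) (D : ExtDatum k S R V) : Prop :=
  IsRBFOps lam (natMul A D) (natP A D) (natTheta A D)

/-- The projection `E → V = ker ρ`, `u ↦ u - ρ(u)`, associated to a linear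
retraction `ρ` of `E` onto the subspace `Rs`. -/
def projV {k E : Type*} [Field k] [AddCommGroup E] [Module k E]
    (Rs : Submodule k E) (ρ : E →ₗ[k] E)
    (hmem : ∀ u : E, ρ u ∈ Rs) (hid : ∀ a ∈ Rs, ρ a = a) (u : E) :
    ↥(LinearMap.ker ρ) :=
  ⟨u - ρ u, by
    have h := hid (ρ u) (hmem u)
    simp [LinearMap.mem_ker, map_sub, h]⟩

/-- `d : V → R` is a deformation map of the Rota-Baxter family Hom extending
structure `Ω(R,V) = Υ₁(E)` associated to the extension `R ⊆ E` and the retraction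
`ρ` (with `V = ker ρ`): writing the maps of `Υ₁(E)` via `ρ` (Eq. (3.3)), the three
deformation-map identities hold. -/
def IsDefMap {k S E : Type*} [Field k] [Semigroup S] [AddCommGroup E] [Module k E]
    (AE : RBFData k S E) (Rs : Submodule k E) (ρ : E →ₗ[k] E)
    (hmem : ∀ u : E, ρ u ∈ Rs) (hid : ∀ a ∈ Rs, ρ a = a)
    (d : ↥(LinearMap.ker ρ) →ₗ[k] ↥Rs) : Prop :=
  (∀ x y : ↥(LinearMap.ker ρ),
     AE.mul ↑(d x) ↑(d y) - (↑(d (projV Rs ρ hmem hid (AE.mul ↑x ↑y))) : E)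
       = (↑(d (projV Rs ρ hmem hid (AE.mul ↑(d x) ↑y)
             + projV Rs ρ hmem hid (AE.mul ↑x ↑(d y)))) : E)
         - ρ (AE.mul ↑(d x) ↑y) - ρ (AE.mul ↑x ↑(d y)) - ρ (AE.mul ↑x ↑y)) ∧
  (∀ (ω : S) (x : ↥(LinearMap.ker ρ)),
     (↑(d (projV Rs ρ hmem hid (AE.P ω ↑x))) : E)
       = ρ (AE.P ω ↑x) + AE.P ω ↑(d x)) ∧
  (∀ x : ↥(LinearMap.ker ρ),
     (↑(d (projV Rs ρ hmem hid (AE.theta ↑x))) : E)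
       = ρ (AE.theta ↑x) + AE.theta ↑(d x))

section Stmt16

variable {k S E : Type*} [Field k] [Semigroup S] [AddCommGroup E] [Module k E]

/-- The set `C(R,E)` of Rota-Baxter family Hom complements of `R` in `E`. -/
def CompSet (AE : RBFData k S E) (Rs : Submodule k E) :=
  {B : Submodule k E //
     (∀ a ∈ B, ∀ b ∈ B, AE.mul a b ∈ B) ∧
     (∀ (ω : S), ∀ a ∈ B, AE.P ω a ∈ B) ∧
     (∀ a ∈ B, AE.theta a ∈ B) ∧
     Rs ⊔ B = ⊤ ∧ Rs ⊓ B = ⊥}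

/-- Two complements are identified when they are isomorphic as Rota-Baxter family
Hom-associative algebras (with the structures induced from `E`). -/
def complIsoRel (AE : RBFData k S E) (Rs : Submodule k E) :
    CompSet AE Rs → CompSet AE Rs → Prop := fun B B' =>
  ∃ ψ : E →ₗ[k] E, Set.BijOn ψ (B.1 : Set E) (B'.1 : Set E) ∧
    (∀ a ∈ B.1, ∀ b ∈ B.1, ψ (AE.mul a b) = AE.mul (ψ a) (ψ b)) ∧
    (∀ (ω : S), ∀ a ∈ B.1, ψ (AE.P ω a) = AE.P ω (ψ a)) ∧
    (∀ a ∈ B.1, ψ (AE.theta a) = AE.theta (ψ a))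

/-- The set `D(R,V)` of deformation maps of `Ω(R,V) = Υ₁(E)`. -/
def DefSet (AE : RBFData k S E) (Rs : Submodule k E) (ρ : E →ₗ[k] E)
    (hmem : ∀ u : E, ρ u ∈ Rs) (hid : ∀ a ∈ Rs, ρ a = a) :=
  {d : ↥(LinearMap.ker ρ) →ₗ[k] ↥Rs // IsDefMap AE Rs ρ hmem hid d}

/-- Two deformation maps `d, D` are equivalent (`d ∼ D`) when there is a linear
automorphism `δ` of `V` satisfying the three compatibility identities of
Definition 4.7 (written via the extending structure `Υ₁(E)`). -/
def defRel (AE : RBFData k S E) (Rs : Submodule k E) (ρ : E →ₗ[k] E)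
    (hmem : ∀ u : E, ρ u ∈ Rs) (hid : ∀ a ∈ Rs, ρ a = a) :
    DefSet AE Rs ρ hmem hid → DefSet AE Rs ρ hmem hid → Prop := fun dc Dc =>
  ∃ δ : ↥(LinearMap.ker ρ) →ₗ[k] ↥(LinearMap.ker ρ), Function.Bijective δ ∧
    (∀ x y : ↥(LinearMap.ker ρ),
      δ (projV Rs ρ hmem hid (AE.mul ↑x ↑y))
          - projV Rs ρ hmem hid (AE.mul ↑(δ x) ↑(δ y))
        = projV Rs ρ hmem hid (AE.mul ↑(Dc.1 (δ x)) ↑(δ y))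
          + projV Rs ρ hmem hid (AE.mul ↑(δ x) ↑(Dc.1 (δ y)))
          - δ (projV Rs ρ hmem hid (AE.mul ↑(dc.1 x) ↑y))
          - δ (projV Rs ρ hmem hid (AE.mul ↑x ↑(dc.1 y)))) ∧
    (∀ (ω : S) (x : ↥(LinearMap.ker ρ)),
      δ (projV Rs ρ hmem hid (AE.P ω ↑x)) = projV Rs ρ hmem hid (AE.P ω ↑(δ x))) ∧
    (∀ x : ↥(LinearMap.ker ρ),
      δ (projV Rs ρ hmem hid (AE.theta ↑x)) = projV Rs ρ hmem hid (AE.theta ↑(δ x)))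

/-- The projection `projV` as a linear map. -/
def projVLin (Rs : Submodule k E) (ρ : E →ₗ[k] E)
    (hmem : ∀ u : E, ρ u ∈ Rs) (hid : ∀ a ∈ Rs, ρ a = a) : E →ₗ[k] ↥(LinearMap.ker ρ) where
  toFun := projV Rs ρ hmem hid
  map_add' u v := by
    ext
    simp only [projV, map_add, Submodule.coe_add]
    abel
  map_smul' c u := by
    ext
    simp only [projV, map_smul, RingHom.id_apply, Submodule.coe_smul, smul_sub]

theorem projVLin_eq_zero {Rs : Submodule k E} {ρ : E →ₗ[k] E}
    (hmem : ∀ u : E, ρ u ∈ Rs) (hid : ∀ a ∈ Rs, ρ a = a) {u : E} (hu : u ∈ Rs) :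
    projVLin Rs ρ hmem hid u = 0 := by
  ext
  simp [projVLin, projV, hid u hu]

/-- The linear map `x ↦ x + d(x)`, whose image is the graph of `d : V → R` inside `E`. -/
def graphMap {Rs : Submodule k E} {ρ : E →ₗ[k] E}
    (d : ↥(LinearMap.ker ρ) →ₗ[k] ↥Rs) : ↥(LinearMap.ker ρ) →ₗ[k] E :=
  (LinearMap.ker ρ).subtype + Rs.subtype ∘ₗ d

theorem graphMap_apply {Rs : Submodule k E} {ρ : E →ₗ[k] E}
    (d : ↥(LinearMap.ker ρ) →ₗ[k] ↥Rs) (x : ↥(LinearMap.ker ρ)) :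
    graphMap d x = (x : E) + (d x : E) := rfl

theorem projVLin_graphMap {Rs : Submodule k E} {ρ : E →ₗ[k] E}
    (hmem : ∀ u : E, ρ u ∈ Rs) (hid : ∀ a ∈ Rs, ρ a = a)
    (d : ↥(LinearMap.ker ρ) →ₗ[k] ↥Rs) (x : ↥(LinearMap.ker ρ)) :
    projVLin Rs ρ hmem hid (graphMap d x) = x := by
  rw [graphMap_apply, map_add, projVLin_eq_zero hmem hid (d x).2, add_zero]
  ext
  simp [projVLin, projV]

/-- Equivalence of deformation maps means that the structures transported to `V` from the
graphs are isomorphic. -/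
theorem defRel_iff (AE : RBFData k S E) (Rs : Submodule k E)
    (hRmul : ∀ a ∈ Rs, ∀ b ∈ Rs, AE.mul a b ∈ Rs)
    (hRP : ∀ (ω : S), ∀ a ∈ Rs, AE.P ω a ∈ Rs)
    (hRtheta : ∀ a ∈ Rs, AE.theta a ∈ Rs)
    (ρ : E →ₗ[k] E) (hmem : ∀ u : E, ρ u ∈ Rs) (hid : ∀ a ∈ Rs, ρ a = a)
    (d D : DefSet AE Rs ρ hmem hid) :
    defRel AE Rs ρ hmem hid d D ↔
      ∃ δ : ↥(LinearMap.ker ρ) →ₗ[k] ↥(LinearMap.ker ρ), Function.Bijective δ ∧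
        (∀ x y, δ (projVLin Rs ρ hmem hid (AE.mul (graphMap d.1 x) (graphMap d.1 y)))
          = projVLin Rs ρ hmem hid (AE.mul (graphMap D.1 (δ x)) (graphMap D.1 (δ y)))) ∧
        (∀ ω x, δ (projVLin Rs ρ hmem hid (AE.P ω (graphMap d.1 x)))
          = projVLin Rs ρ hmem hid (AE.P ω (graphMap D.1 (δ x)))) ∧
        (∀ x, δ (projVLin Rs ρ hmem hid (AE.theta (graphMap d.1 x)))
          = projVLin Rs ρ hmem hid (AE.theta (graphMap D.1 (δ x)))) := by
  have hcoe : ∀ u, projV Rs ρ hmem hid u = projVLin Rs ρ hmem hid u := fun _ => rfl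
  have hmul : ∀ (c : DefSet AE Rs ρ hmem hid) x y,
      projVLin Rs ρ hmem hid (AE.mul (graphMap c.1 x) (graphMap c.1 y))
        = projVLin Rs ρ hmem hid (AE.mul x y) + projVLin Rs ρ hmem hid (AE.mul (c.1 x) y)
          + projVLin Rs ρ hmem hid (AE.mul x (c.1 y)) := by
    intro c x y
    have h := projVLin_eq_zero hmem hid (hRmul _ (c.1 x).2 _ (c.1 y).2)
    simp only [graphMap_apply, map_add, LinearMap.add_apply, h]
    abel
  have hP : ∀ (c : DefSet AE Rs ρ hmem hid) ω x,
      projVLin Rs ρ hmem hid (AE.P ω (graphMap c.1 x))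
        = projVLin Rs ρ hmem hid (AE.P ω x) := by
    intro c ω x
    simp only [graphMap_apply, map_add, projVLin_eq_zero hmem hid (hRP ω _ (c.1 x).2), add_zero]
  have htheta : ∀ (c : DefSet AE Rs ρ hmem hid) x,
      projVLin Rs ρ hmem hid (AE.theta (graphMap c.1 x))
        = projVLin Rs ρ hmem hid (AE.theta x) := by
    intro c x
    simp only [graphMap_apply, map_add, projVLin_eq_zero hmem hid (hRtheta _ (c.1 x).2), add_zero]
  simp only [defRel, hcoe, hmul, hP, htheta, map_add]
  refine exists_congr fun δ => and_congr_right fun _ => and_congr_left fun _ =>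
    forall₂_congr fun x y => ?_
  constructor <;> intro h
  · rw [sub_eq_iff_eq_add] at h
    rw [h]
    abel
  · rw [sub_eq_iff_eq_add, ← sub_eq_zero]
    rw [← sub_eq_zero] at h
    rw [← h]
    abel

/-- Complements are isomorphic exactly when the deformation maps having them as graphs are
equivalent. -/
theorem complIsoRel_iff_defRel (AE : RBFData k S E) (Rs : Submodule k E)
    (hRmul : ∀ a ∈ Rs, ∀ b ∈ Rs, AE.mul a b ∈ Rs)
    (hRP : ∀ (ω : S), ∀ a ∈ Rs, AE.P ω a ∈ Rs)
    (hRtheta : ∀ a ∈ Rs, AE.theta a ∈ Rs)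
    (ρ : E →ₗ[k] E) (hmem : ∀ u : E, ρ u ∈ Rs) (hid : ∀ a ∈ Rs, ρ a = a)
    (B B' : CompSet AE Rs) (d D : DefSet AE Rs ρ hmem hid)
    (hd : ∀ x, graphMap d.1 x ∈ B.1)
    (hd' : ∀ b ∈ B.1, graphMap d.1 (projVLin Rs ρ hmem hid b) = b)
    (hD : ∀ x, graphMap D.1 x ∈ B'.1)
    (hD' : ∀ b ∈ B'.1, graphMap D.1 (projVLin Rs ρ hmem hid b) = b) :
    complIsoRel AE Rs B B' ↔ defRel AE Rs ρ hmem hid d D := by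
  rw [defRel_iff AE Rs hRmul hRP hRtheta]
  obtain ⟨hBmul, hBP, hBtheta, -⟩ := B.2
  obtain ⟨hBmul', hBP', hBtheta', -⟩ := B'.2
  have hπ := projVLin_graphMap hmem hid d.1
  have hπ' := projVLin_graphMap hmem hid D.1
  constructor
  · rintro ⟨ψ, hψ, hψmul, hψP, hψtheta⟩
    have hψγ : ∀ x, graphMap D.1 (projVLin Rs ρ hmem hid (ψ (graphMap d.1 x)))
        = ψ (graphMap d.1 x) := fun x => hD' _ (hψ.mapsTo (hd x))
    refine ⟨projVLin Rs ρ hmem hid ∘ₗ ψ ∘ₗ graphMap d.1, ⟨?_, ?_⟩, ?_, ?_, ?_⟩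
    · intro x y hxy
      have h := congrArg (graphMap D.1) hxy
      simp only [LinearMap.comp_apply, hψγ] at h
      rw [← hπ x, ← hπ y, hψ.injOn (hd x) (hd y) h]
    · intro y
      obtain ⟨b, hb, hby⟩ := hψ.surjOn (hD y)
      refine ⟨projVLin Rs ρ hmem hid b, ?_⟩
      simp only [LinearMap.comp_apply]
      rw [hd' b hb, hby, hπ']
    · intro x y
      simp only [LinearMap.comp_apply, hψγ]
      rw [hd' _ (hBmul _ (hd x) _ (hd y)), hψmul _ (hd x) _ (hd y)]
    · intro ω x
      simp only [LinearMap.comp_apply, hψγ]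
      rw [hd' _ (hBP ω _ (hd x)), hψP ω _ (hd x)]
    · intro x
      simp only [LinearMap.comp_apply, hψγ]
      rw [hd' _ (hBtheta _ (hd x)), hψtheta _ (hd x)]
  · rintro ⟨δ, hδ, hδmul, hδP, hδtheta⟩
    refine ⟨graphMap D.1 ∘ₗ δ ∘ₗ projVLin Rs ρ hmem hid, ⟨?_, ?_, ?_⟩, ?_, ?_, ?_⟩
    · exact fun b _ => hD _
    · intro b hb c hc hbc
      have h := congrArg (projVLin Rs ρ hmem hid) hbc
      simp only [LinearMap.comp_apply, hπ'] at h
      rw [← hd' b hb, ← hd' c hc, hδ.1 h]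
    · intro c hc
      obtain ⟨x, hx⟩ := hδ.2 (projVLin Rs ρ hmem hid c)
      refine ⟨graphMap d.1 x, hd x, ?_⟩
      simp only [LinearMap.comp_apply]
      rw [hπ, hx, hD' c hc]
    · intro a ha b hb
      have h := hδmul (projVLin Rs ρ hmem hid a) (projVLin Rs ρ hmem hid b)
      rw [hd' a ha, hd' b hb] at h
      simp only [LinearMap.comp_apply]
      rw [h, hD' _ (hBmul' _ (hD _) _ (hD _))]
    · intro ω a ha
      have h := hδP ω (projVLin Rs ρ hmem hid a)
      rw [hd' a ha] at h
      simp only [LinearMap.comp_apply]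
      rw [h, hD' _ (hBP' ω _ (hD _))]
    · intro a ha
      have h := hδtheta (projVLin Rs ρ hmem hid a)
      rw [hd' a ha] at h
      simp only [LinearMap.comp_apply]
      rw [h, hD' _ (hBtheta' _ (hD _))]

/-- A complement `B` of `R` is the graph of `-d̃` restricted to `V`, where `d̃` is the retraction
onto `R` along `B`. -/
theorem graphMap_of_retraction (Rs B : Submodule k E) (hsup : Rs ⊔ B = ⊤) (hinf : Rs ⊓ B = ⊥)
    (ρ : E →ₗ[k] E) (hmem : ∀ u : E, ρ u ∈ Rs) (hid : ∀ a ∈ Rs, ρ a = a)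
    (d : ↥(LinearMap.ker ρ) →ₗ[k] ↥Rs)
    (hd : ∀ dt : E →ₗ[k] E, (∀ a ∈ Rs, ∀ b ∈ B, dt (a + b) = a) →
      ∀ x : ↥(LinearMap.ker ρ), (d x : E) = -(dt x)) :
    (∀ x, graphMap d x ∈ B) ∧ ∀ b ∈ B, graphMap d (projVLin Rs ρ hmem hid b) = b := by
  have hc : IsCompl Rs B := ⟨disjoint_iff.2 hinf, codisjoint_iff.2 hsup⟩
  have hdt : ∀ a ∈ Rs, ∀ b ∈ B, (Rs.subtype ∘ₗ Rs.projectionOnto B hc) (a + b) = a := by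
    intro a ha b hb
    have h₁ := Submodule.projectionOnto_apply_left hc ⟨a, ha⟩
    have h₂ := Submodule.projectionOnto_apply_right hc ⟨b, hb⟩
    simp only at h₁ h₂
    simp [h₁, h₂]
  generalize Rs.subtype ∘ₗ Rs.projectionOnto B hc = dt at hdt
  have hd := hd dt hdt
  have hR : ∀ a ∈ Rs, dt a = a := fun a ha => by simpa using hdt a ha 0 B.zero_mem
  have hB : ∀ b ∈ B, dt b = 0 := fun b hb => by simpa using hdt 0 Rs.zero_mem b hb
  constructor
  · intro x
    obtain ⟨a, ha, b, hb, hab⟩ := Submodule.mem_sup.1 (hsup ▸ Submodule.mem_top : (x : E) ∈ Rs ⊔ B)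
    rw [graphMap_apply, hd x, ← hab, hdt a ha b hb, add_neg_cancel_comm]
    exact hb
  · intro b hb
    rw [graphMap_apply, hd]
    simp [projVLin, projV, hR _ (hmem b), hB b hb]

/-- Theorem 4.9: the bijection `Δ₁ : C(R,E) → D(R,V)` induces a bijection
`Δ : CH²(R,E) → H²(R,V)` between the isomorphism classes of Rota-Baxter family Hom
complements of `R` in `E` and the equivalence classes of deformation maps, sending
`[B]` to `[Δ₁(B)]`; in particular the index `[E : R]` equals `|H²(R,V)|`. -/
theorem stmt16 (lam : k) (AE : RBFData k S E) (hAE : AE.IsRBF lam)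
    (Rs : Submodule k E)
    (hRmul : ∀ a ∈ Rs, ∀ b ∈ Rs, AE.mul a b ∈ Rs)
    (hRP : ∀ (ω : S), ∀ a ∈ Rs, AE.P ω a ∈ Rs)
    (hRtheta : ∀ a ∈ Rs, AE.theta a ∈ Rs)
    (ρ : E →ₗ[k] E) (hmem : ∀ u : E, ρ u ∈ Rs) (hid : ∀ a ∈ Rs, ρ a = a)
    -- F is the bijection Δ₁ of Proposition 4.5:
    (F : CompSet AE Rs → DefSet AE Rs ρ hmem hid)
    (hF : ∀ Bc, ∀ dt : E →ₗ[k] E, (∀ a ∈ Rs, ∀ b ∈ Bc.1, dt (a + b) = a) →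
        ∀ x : ↥(LinearMap.ker ρ), (↑((F Bc).1 x) : E) = -(dt ↑x))
    (hFbij : Function.Bijective F) :
    (∃ Fbar : Quot (complIsoRel AE Rs) ≃ Quot (defRel AE Rs ρ hmem hid),
       ∀ Bc : CompSet AE Rs, Fbar (Quot.mk _ Bc) = Quot.mk _ (F Bc)) ∧
    Cardinal.mk (Quot (complIsoRel AE Rs)) = Cardinal.mk (Quot (defRel AE Rs ρ hmem hid)) := by
  have hgraph : ∀ B : CompSet AE Rs, (∀ x, graphMap (F B).1 x ∈ B.1) ∧
      ∀ b ∈ B.1, graphMap (F B).1 (projVLin Rs ρ hmem hid b) = b := fun B =>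
    graphMap_of_retraction Rs B.1 B.2.2.2.2.1 B.2.2.2.2.2 ρ hmem hid (F B).1 (hF B)
  have hrel : ∀ B B' : CompSet AE Rs,
      complIsoRel AE Rs B B' ↔ defRel AE Rs ρ hmem hid (F B) (F B') := fun B B' =>
    complIsoRel_iff_defRel AE Rs hRmul hRP hRtheta ρ hmem hid B B' (F B) (F B')
      (hgraph B).1 (hgraph B).2 (hgraph B').1 (hgraph B').2
  let Fbar := Quot.congr (Equiv.ofBijective F hFbij) hrel
  exact ⟨⟨Fbar, fun _ => rfl⟩, Cardinal.mk_congr Fbar⟩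

end Stmt16
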